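/- (Power-series-family space-time covariance.) Let d ≥ 1 and let ρ_1, ρ_2 ∈ (0,1]. Then the function C : ℝ^d × ℝ → ℝ given by C(h, u) = 1 − (1 − e^{−‖h‖})^{ρ_1} − (1 − e^{−|u|})^{ρ_2} + (1 − e^{−‖h‖})^{ρ_1} (1 − e^{−|u|})^{ρ_2}, where ‖·‖ is the Euclidean norm on ℝ^d, is positive definite on ℝ^d × ℝ. -/

import Mathlib

/-- `C : V → ℝ` is a positive definite function on the additive group `V`. -/
def IsPosDefFn {V : Type*} [AddCommGroup V] (C : V → ℝ) : Prop :=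
  ∀ (m : ℕ) (z : Fin m → V) (c : Fin m → ℝ),
    0 ≤ ∑ k : Fin m, ∑ l : Fin m, c k * c l * C (z k - z l)

/-- Symmetric positive semidefinite kernels on a finite index set. -/
def PSK {m : ℕ} (K : Fin m → Fin m → ℝ) : Prop :=
  (Matrix.of K).PosSemidef

lemma psk_iff {m : ℕ} (K : Fin m → Fin m → ℝ) :
    PSK K ↔ (∀ i j, K i j = K j i) ∧
      ∀ c : Fin m → ℝ, 0 ≤ ∑ k, ∑ l, c k * c l * K k l := by
  unfold PSK
  rw [Matrix.posSemidef_iff_dotProduct_mulVec]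
  refine and_congr ?_ (forall_congr' fun c => ?_)
  · rw [Matrix.IsHermitian.ext_iff]
    simp only [Matrix.of_apply, star_trivial]
    exact ⟨fun h i j => h j i, fun h i j => h j i⟩
  · have : star c ⬝ᵥ (Matrix.of K).mulVec c = ∑ k, ∑ l, c k * c l * K k l := by
      simp only [dotProduct, Matrix.mulVec, Finset.mul_sum, Matrix.of_apply, star_trivial]
      refine Finset.sum_congr rfl fun k _ => Finset.sum_congr rfl fun l _ => ?_
      ring
    rw [this]

lemma PSK.mul {m : ℕ} {K L : Fin m → Fin m → ℝ} (hK : PSK K) (hL : PSK L) :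
    PSK (fun i j => K i j * L i j) :=
  Matrix.PosSemidef.hadamard hK hL

lemma PSK.add {m : ℕ} {K L : Fin m → Fin m → ℝ} (hK : PSK K) (hL : PSK L) :
    PSK (fun i j => K i j + L i j) :=
  Matrix.PosSemidef.add hK hL

lemma PSK.rank_one {m : ℕ} (v : Fin m → ℝ) : PSK (fun i j => v i * v j) := by
  rw [psk_iff]
  refine ⟨fun i j => mul_comm _ _, fun c => ?_⟩
  have : ∑ k, ∑ l, c k * c l * (v k * v l) = (∑ k, c k * v k) * (∑ l, c l * v l) := by
    rw [Finset.sum_mul_sum]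
    refine Finset.sum_congr rfl fun k _ => Finset.sum_congr rfl fun l _ => ?_
    ring
  rw [this]
  exact mul_self_nonneg _

lemma PSK.const {m : ℕ} {a : ℝ} (ha : 0 ≤ a) :
    PSK (fun _ _ : Fin m => a) := by
  have h := PSK.rank_one (fun _ : Fin m => Real.sqrt a)
  simpa [Real.mul_self_sqrt ha] using h

lemma PSK.smul {m : ℕ} {K : Fin m → Fin m → ℝ} (hK : PSK K) {a : ℝ} (ha : 0 ≤ a) :
    PSK (fun i j => a * K i j) :=
  (PSK.const ha).mul hK

lemma PSK.pow {m : ℕ} {K : Fin m → Fin m → ℝ} (hK : PSK K) (n : ℕ) :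
    PSK (fun i j => K i j ^ n) := by
  induction n with
  | zero => simpa using PSK.const (m := m) zero_le_one
  | succ n ih => simpa only [pow_succ] using ih.mul hK

lemma PSK.sum {m : ℕ} {K : ℕ → Fin m → Fin m → ℝ} (hK : ∀ n, PSK (K n)) (s : Finset ℕ) :
    PSK (fun i j => ∑ n ∈ s, K n i j) := by
  induction s using Finset.induction_on with
  | empty => simpa using PSK.const (m := m) le_rfl
  | insert a s ha ih =>
    simp only [Finset.sum_insert ha]
    exact (hK a).add ih

lemma PSK.lim {m : ℕ} {ι : Type*} {f : Filter ι} [f.NeBot] {K : ι → Fin m → Fin m → ℝ}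
    {L : Fin m → Fin m → ℝ} (hK : ∀ᶠ n in f, PSK (K n))
    (hL : ∀ i j, Filter.Tendsto (fun n => K n i j) f (nhds (L i j))) : PSK L := by
  rw [psk_iff]
  constructor
  · intro i j
    refine tendsto_nhds_unique_of_eventuallyEq (hL i j) (hL j i) ?_
    filter_upwards [hK] with n hn using ((psk_iff _).1 hn).1 i j
  · intro c
    refine ge_of_tendsto (f := fun n => ∑ k, ∑ l, c k * c l * K n k l) (x := f) ?_ ?_
    · exact tendsto_finsetSum _ fun k _ => tendsto_finsetSum _ fun l _ =>
        (hL k l).const_mul _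
    · filter_upwards [hK] with n hn using ((psk_iff _).1 hn).2 c

lemma PSK.series {m : ℕ} {K F : Fin m → Fin m → ℝ} (hK : PSK K) {a : ℕ → ℝ}
    (ha : ∀ n, 0 ≤ a n) (hF : ∀ i j, HasSum (fun n => a n * K i j ^ n) (F i j)) : PSK F := by
  refine PSK.lim (f := Filter.atTop)
    (K := fun s : Finset ℕ => fun i j => ∑ n ∈ s, a n * K i j ^ n)
    (Filter.Eventually.of_forall fun s => ?_) (fun i j => hF i j)
  exact PSK.sum (fun n => (hK.pow n).smul (ha n)) s

lemma PSK.exp {m : ℕ} {K : Fin m → Fin m → ℝ} (hK : PSK K) :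
    PSK (fun i j => Real.exp (K i j)) := by
  refine hK.series (a := fun n => ((n.factorial : ℝ))⁻¹) (fun n => by positivity) fun i j => ?_
  have h := NormedSpace.expSeries_div_hasSum_exp (𝔸 := ℝ) (K i j)
  rw [← Real.exp_eq_exp_ℝ] at h
  simpa [div_eq_inv_mul] using h

lemma desc_sign {ρ : ℝ} (h0 : 0 < ρ) (h1 : ρ ≤ 1) (n : ℕ) :
    0 ≤ (-1) ^ n * (descPochhammer ℤ (n + 1)).smeval ρ := by
  induction n with
  | zero => simp [h0.le]
  | succ n ih =>
    have : (descPochhammer ℤ (n + 1 + 1)).smeval ρ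
        = (descPochhammer ℤ (n + 1)).smeval ρ * (ρ - (n + 1)) := by
      rw [descPochhammer_succ_right, Polynomial.smeval_mul]
      simp [Polynomial.smeval_sub, Polynomial.smeval_natCast]
    rw [this]
    have h2 : 0 ≤ (n + 1 : ℝ) - ρ := by
      have : (0 : ℝ) ≤ n := Nat.cast_nonneg n
      linarith
    have := mul_nonneg ih h2
    rw [pow_succ]
    linarith

lemma choose_sign {ρ : ℝ} (h0 : 0 < ρ) (h1 : ρ ≤ 1) (n : ℕ) :
    0 ≤ (if n = 0 then 1 else 0) - (-1) ^ n * Ring.choose ρ n := by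
  cases n with
  | zero => simp
  | succ n =>
    rw [Ring.choose_eq_smul, smul_eq_mul]
    have h := mul_nonneg (inv_nonneg.2 (Nat.cast_nonneg (α := ℝ) (n + 1).factorial))
      (desc_sign h0 h1 n)
    rw [pow_succ]
    simp only [Nat.add_eq_zero_iff, one_ne_zero, and_false, if_false]
    linarith

lemma hasSum_one_sub {ρ x : ℝ} (hx : |x| < 1) :
    HasSum (fun n : ℕ => ((if n = 0 then 1 else 0) - (-1) ^ n * Ring.choose ρ n) * x ^ n)
      (1 - (1 - x) ^ ρ) := by
  have h := (Real.one_add_rpow_hasFPowerSeriesOnBall_zero (a := ρ)).hasSum (y := -x)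
    (by simpa [enorm_eq_nnnorm, ← NNReal.coe_lt_coe] using hx)
  have h1 : HasSum (fun n : ℕ => if n = 0 then (1 : ℝ) else 0) 1 := by
    simpa using hasSum_ite_eq (0 : ℕ) (1 : ℝ)
  have h2 := h1.sub h
  convert h2 using 1
  · rfl
  · funext n
    rw [binomialSeries_apply]
    simp only [List.ofFn_const, List.prod_replicate, smul_eq_mul]
    rw [neg_pow x n]
    by_cases hn : n = 0
    · subst hn; simp
    · simp only [hn, if_false]; ring
  · ring_nf

lemma PSK.one_sub_rpow {m : ℕ} {K : Fin m → Fin m → ℝ} (hK : PSK K)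
    (hb : ∀ i j, |K i j| ≤ 1) {ρ : ℝ} (h0 : 0 < ρ) (h1 : ρ ≤ 1) :
    PSK (fun i j => 1 - (1 - K i j) ^ ρ) := by
  refine PSK.lim (f := nhdsWithin (1 : ℝ) (Set.Iio 1))
    (K := fun s i j => 1 - (1 - s * K i j) ^ ρ) ?_ fun i j => ?_
  · have : ∀ᶠ s in nhdsWithin (1 : ℝ) (Set.Iio 1), s ∈ Set.Ioo (0 : ℝ) 1 :=
      Ioo_mem_nhdsLT zero_lt_one
    filter_upwards [this] with s hs
    refine (hK.smul hs.1.le).series (choose_sign h0 h1) fun i j => hasSum_one_sub ?_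
    rw [abs_mul, abs_of_pos hs.1]
    nlinarith [hb i j, abs_nonneg (K i j), hs.1, hs.2]
  · have hc : Continuous fun s : ℝ => 1 - (1 - s * K i j) ^ ρ :=
      continuous_const.sub ((continuous_const.sub (continuous_id.mul continuous_const)).rpow_const
        fun _ => Or.inr h0.le)
    have := (hc.tendsto 1).mono_left (nhdsWithin_le_nhds (s := Set.Iio 1))
    simpa using this

lemma PSK.gauss {V : Type*} [NormedAddCommGroup V] [InnerProductSpace ℝ V] {m : ℕ}
    (z : Fin m → V) {t : ℝ} (ht : 0 ≤ t) :
    PSK (fun i j => Real.exp (-(t * ‖z i - z j‖ ^ 2))) := by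
  have hg : PSK (fun i j => inner ℝ (z i) (z j)) := Matrix.posSemidef_gram ℝ z
  have h := (hg.smul (a := 2 * t) (by positivity)).exp.mul
    (PSK.rank_one fun i => Real.exp (-(t * ‖z i‖ ^ 2)))
  convert h using 3 with i j
  rw [← Real.exp_add, ← Real.exp_add, norm_sub_sq_real]
  ring_nf

lemma tendsto_aux (r : ℝ) (hr : 0 ≤ r) :
    Filter.Tendsto (fun s : ℝ => (1 / Real.sqrt s) * (1 - Real.exp (-(s * r ^ 2))) ^ (1 / 2 : ℝ))
      (nhdsWithin 0 (Set.Ioi 0)) (nhds r) := by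
  have hd : HasDerivAt (fun s : ℝ => 1 - Real.exp (-(s * r ^ 2))) (r ^ 2) 0 := by
    have := (((hasDerivAt_id (0 : ℝ)).mul_const (r ^ 2)).neg.exp).const_sub 1
    simpa using this
  have h := hd.tendsto_slope_zero_right
  have h2 := (Real.continuous_sqrt.tendsto _).comp h
  rw [Real.sqrt_sq hr] at h2
  refine h2.congr' ?_
  filter_upwards [self_mem_nhdsWithin] with s hs
  have hs : 0 < s := hs
  simp only [Function.comp, zero_add, zero_mul, neg_zero, Real.exp_zero, sub_self, sub_zero,
    smul_eq_mul]
  rw [Real.sqrt_mul (inv_nonneg.2 hs.le), Real.sqrt_inv, Real.sqrt_eq_rpow (1 - _), one_div (Real.sqrt s)]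

lemma PSK.exp_norm {V : Type*} [NormedAddCommGroup V] [InnerProductSpace ℝ V] {m : ℕ}
    (z : Fin m → V) : PSK (fun i j => Real.exp (-‖z i - z j‖)) := by
  refine PSK.lim (f := nhdsWithin (0 : ℝ) (Set.Ioi 0))
    (K := fun s i j => Real.exp (-((1 / Real.sqrt s) *
      (1 - Real.exp (-(s * ‖z i - z j‖ ^ 2))) ^ (1 / 2 : ℝ)))) ?_ fun i j => ?_
  · filter_upwards [self_mem_nhdsWithin] with s hs
    have hs : 0 < s := hs
    have h1 := (PSK.gauss z hs.le).one_sub_rpow (fun i j => by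
      rw [abs_of_pos (Real.exp_pos _), Real.exp_le_one_iff]
      have := mul_nonneg hs.le (sq_nonneg ‖z i - z j‖)
      linarith) (ρ := 1 / 2) (by norm_num) (by norm_num)
    have h2 := (h1.smul (a := 1 / Real.sqrt s) (by positivity)).exp.smul
      (Real.exp_pos (-(1 / Real.sqrt s))).le
    convert h2 using 3 with i j
    rw [← Real.exp_add]
    ring_nf
  · exact (Real.continuous_exp.tendsto _).comp (tendsto_aux _ (norm_nonneg _)).neg

lemma PSK.family {V : Type*} [NormedAddCommGroup V] [InnerProductSpace ℝ V] {m : ℕ}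
    (z : Fin m → V) {ρ : ℝ} (h : ρ ∈ Set.Ioc (0 : ℝ) 1) :
    PSK (fun i j => 1 - (1 - Real.exp (-‖z i - z j‖)) ^ ρ) :=
  (PSK.exp_norm z).one_sub_rpow (fun i j => by
    rw [abs_of_pos (Real.exp_pos _), Real.exp_le_one_iff]
    linarith [norm_nonneg (z i - z j)]) h.1 h.2

/-- Power-series-family space-time covariance: for `ρ₁, ρ₂ ∈ (0,1]`, the
function
`C(h,u) = 1 − (1 − e^{−‖h‖})^{ρ₁} − (1 − e^{−|u|})^{ρ₂}
          + (1 − e^{−‖h‖})^{ρ₁} (1 − e^{−|u|})^{ρ₂}`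
is positive definite on `ℝ^d × ℝ` (Euclidean norm on `ℝ^d`). -/
theorem powerSeries_spaceTime_posDef
    (d : ℕ) (hd : 1 ≤ d)
    (ρ₁ ρ₂ : ℝ) (hρ₁ : ρ₁ ∈ Set.Ioc (0 : ℝ) 1) (hρ₂ : ρ₂ ∈ Set.Ioc (0 : ℝ) 1) :
    IsPosDefFn (fun hu : EuclideanSpace ℝ (Fin d) × ℝ =>
      1 - (1 - Real.exp (-‖hu.1‖)) ^ ρ₁ - (1 - Real.exp (-|hu.2|)) ^ ρ₂
        + (1 - Real.exp (-‖hu.1‖)) ^ ρ₁ * (1 - Real.exp (-|hu.2|)) ^ ρ₂) := by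
  intro m z c
  have h := ((psk_iff _).1 ((PSK.family (fun i => (z i).1) hρ₁).mul
    (PSK.family (fun i => (z i).2) hρ₂))).2 c
  convert h using 5 with k _ l _
  simp only [Prod.fst_sub, Prod.snd_sub, Real.norm_eq_abs]
  ring
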